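/- arXiv:2106.00220 — 4 statements merged into one kernel-verified Lean document; each statement's English description precedes it below -/
import Mathlib

section
/- Let p₀, p₁, p₂ be three affinely independent points in a Euclidean affine space, let R be the circumradius of the triangle, let ℓ_min be the minimum of the three pairwise distances, and let θ_min be the minimum of the three unsigned corner angles of the triangle. Then for every real α with 0 < α ≤ π/3, one has θ_min ≥ α if and only if R ≤ ℓ_min / (2 sin α). -/
open Real EuclideanGeometry

/-- For `0 < α`, the sine is at least `sin α` on `[α, π - α]`. -/
lemma sin_le_sin_of_le_of_le_pi_sub {α x : ℝ} (hα0 : 0 < α) (hx : α ≤ x) (hx' : x ≤ π - α) :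
    Real.sin α ≤ Real.sin x := by
  rcases le_total x (π / 2) with h | h
  · exact Real.sin_le_sin_of_le_of_le_pi_div_two (by linarith [Real.pi_pos]) h hx
  · rw [← Real.sin_pi_sub x]
    exact Real.sin_le_sin_of_le_of_le_pi_div_two (by linarith [Real.pi_pos]) (by linarith)
      (by linarith)

/-- For `α ≤ π / 2`, an angle whose sine is at least `sin α` is at least `α`. -/
lemma le_of_sin_le_sin {α x : ℝ} (hα : α ≤ π / 2) (hx : 0 ≤ x)
    (h : Real.sin α ≤ Real.sin x) : α ≤ x := by
  by_contra! hlt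
  exact absurd h (not_le.2 (Real.sin_lt_sin_of_lt_of_le_pi_div_two
    (by linarith [Real.pi_pos]) hα hlt))

/-- Equivalence between a minimum angle bound α and a circumradius-to-shortest-edge
ratio bound 1/(2 sin α), for 0 < α ≤ π/3. -/
theorem min_angle_ge_iff_circumradius_le
    {V P : Type*} [NormedAddCommGroup V] [InnerProductSpace ℝ V]
    [MetricSpace P] [NormedAddTorsor V P]
    (p₀ p₁ p₂ : P) (h : AffineIndependent ℝ ![p₀, p₁, p₂])
    (R : ℝ) (hR : R = (⟨![p₀, p₁, p₂], h⟩ : Affine.Simplex ℝ P 2).circumradius)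
    (ℓmin : ℝ) (hℓ : ℓmin = min (dist p₀ p₁) (min (dist p₁ p₂) (dist p₂ p₀)))
    (θmin : ℝ) (hθ : θmin = min (∠ p₁ p₀ p₂) (min (∠ p₀ p₁ p₂) (∠ p₀ p₂ p₁)))
    (α : ℝ) (hα0 : 0 < α) (hα : α ≤ π / 3) :
    θmin ≥ α ↔ R ≤ ℓmin / (2 * Real.sin α) := by
  have hπ := Real.pi_pos
  have hRpos : 0 < R := hR ▸ Affine.Simplex.circumradius_pos _
  have hsα : 0 < Real.sin α := Real.sin_pos_of_pos_of_lt_pi hα0 (by linarith)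
  have law : ∀ i₁ i₂ i₃ : Fin 3, i₁ ≠ i₂ → i₁ ≠ i₃ → i₂ ≠ i₃ →
      dist (![p₀, p₁, p₂] i₁) (![p₀, p₁, p₂] i₃) =
        2 * R * Real.sin (∠ (![p₀, p₁, p₂] i₁) (![p₀, p₁, p₂] i₂) (![p₀, p₁, p₂] i₃)) := by
    intro i₁ i₂ i₃ h₁₂ h₁₃ h₂₃
    have e := Affine.Triangle.dist_div_sin_angle_eq_two_mul_circumradius
      (⟨![p₀, p₁, p₂], h⟩ : Affine.Simplex ℝ P 2) h₁₂ h₁₃ h₂₃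
    rw [← hR] at e
    rw [← e, div_mul_cancel₀]
    intro h0
    simp only [h0, div_zero] at e
    linarith
  have d₁ : dist p₁ p₂ = 2 * R * Real.sin (∠ p₁ p₀ p₂) :=
    law 1 0 2 (by decide) (by decide) (by decide)
  have d₂ : dist p₂ p₀ = 2 * R * Real.sin (∠ p₀ p₁ p₂) := by
    rw [dist_comm]
    exact law 0 1 2 (by decide) (by decide) (by decide)
  have d₃ : dist p₀ p₁ = 2 * R * Real.sin (∠ p₀ p₂ p₁) :=
    law 0 2 1 (by decide) (by decide) (by decide)
  have hne : p₁ ≠ p₀ := fun e => absurd (h.injective (a₁ := 1) (a₂ := 0) e) (by decide)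
  have hsum : ∠ p₁ p₀ p₂ + ∠ p₀ p₁ p₂ + ∠ p₀ p₂ p₁ = π := by
    have := angle_add_angle_add_angle_eq_pi p₂ hne
    rw [angle_comm p₁ p₀ p₂, angle_comm p₀ p₂ p₁]
    linarith
  have key : ∀ x, 2 * R * Real.sin α ≤ 2 * R * Real.sin x ↔ Real.sin α ≤ Real.sin x :=
    fun x => mul_le_mul_iff_right₀ (by positivity)
  rw [ge_iff_le, le_div_iff₀ (by positivity),
    show R * (2 * Real.sin α) = 2 * R * Real.sin α by ring, hθ, hℓ]
  simp only [le_min_iff, d₁, d₂, d₃, key]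
  constructor
  · rintro ⟨h₀, h₁, h₂⟩
    refine ⟨?_, ?_, ?_⟩ <;> apply sin_le_sin_of_le_of_le_pi_sub hα0 <;> linarith
  · rintro ⟨h₂, h₀, h₁⟩
    have hα' : α ≤ π / 2 := by linarith
    exact ⟨le_of_sin_le_sin hα' (angle_nonneg _ _ _) h₀,
      le_of_sin_le_sin hα' (angle_nonneg _ _ _) h₁, le_of_sin_le_sin hα' (angle_nonneg _ _ _) h₂⟩
end

section
/- Let p_i, p_j, p_k be three affinely independent points in a Euclidean affine space, with edge lengths ℓ_ij = dist(p_i, p_j), ℓ_jk = dist(p_j, p_k), ℓ_ki = dist(p_k, p_i). Define the homogeneous weights v̂_i = ℓ_jk²(ℓ_ij² + ℓ_ki² − ℓ_jk²), v̂_j = ℓ_ki²(ℓ_ij² + ℓ_jk² − ℓ_ki²), v̂_k = ℓ_ij²(ℓ_jk² + ℓ_ki² − ℓ_ij²). Then v̂_i + v̂_j + v̂_k ≠ 0, and the circumcenter of the triangle equals the affine combination of p_i, p_j, p_k with weights v̂_i/(v̂_i+v̂_j+v̂_k), v̂_j/(v̂_i+v̂_j+v̂_k), v̂_k/(v̂_i+v̂_j+v̂_k).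 -/
open Real EuclideanGeometry

/-- The Cauchy–Schwarz inequality is strict for two edge vectors of a nondegenerate triangle. -/
lemma AffineIndependent.gram_ne_zero
    {V P : Type*} [NormedAddCommGroup V] [InnerProductSpace ℝ V]
    [MetricSpace P] [NormedAddTorsor V P]
    {p q r : P} (h : AffineIndependent ℝ ![p, q, r]) :
    ‖q -ᵥ p‖ ^ 2 * ‖r -ᵥ p‖ ^ 2 - inner ℝ (q -ᵥ p) (r -ᵥ p) ^ 2 ≠ 0 := by
  intro h0
  set c := inner ℝ (q -ᵥ p) (r -ᵥ p) with hc
  have hzero : ‖r -ᵥ p‖ ^ 2 • (q -ᵥ p) - c • (r -ᵥ p) = 0 := by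
    rw [← norm_eq_zero, ← sq_eq_zero_iff, norm_sub_sq_real, inner_smul_left, inner_smul_right,
      norm_smul, norm_smul, ← hc, mul_pow, mul_pow, Real.norm_eq_abs, Real.norm_eq_abs,
      sq_abs, sq_abs, conj_trivial]
    linear_combination ‖r -ᵥ p‖ ^ 2 * h0
  have hw : ∑ i, ![c - ‖r -ᵥ p‖ ^ 2, ‖r -ᵥ p‖ ^ 2, -c] i = 0 := by
    simp [Fin.sum_univ_three]
  have hcoeff := h Finset.univ ![c - ‖r -ᵥ p‖ ^ 2, ‖r -ᵥ p‖ ^ 2, -c] hw (by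
    rw [Finset.weightedVSub_eq_weightedVSubOfPoint_of_sum_eq_zero _ _ _ hw p,
      Finset.weightedVSubOfPoint_apply, Fin.sum_univ_three]
    simpa [sub_eq_add_neg] using hzero) 1 (Finset.mem_univ _)
  have hr : r = p := by simpa using hcoeff
  exact absurd (h.injective (a₁ := 2) (a₂ := 0) hr) (by decide)

/-- The circumcenter of a nondegenerate triangle is the affine combination of its
vertices with the homogeneous barycentric weights
v̂_i = ℓ_jk²(ℓ_ij² + ℓ_ki² − ℓ_jk²) and cyclic permutations, normalized. -/
theorem circumcenter_eq_affineCombination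
    {V P : Type*} [NormedAddCommGroup V] [InnerProductSpace ℝ V]
    [MetricSpace P] [NormedAddTorsor V P]
    (pi pj pk : P) (h : AffineIndependent ℝ ![pi, pj, pk])
    (ℓij ℓjk ℓki : ℝ)
    (hij : ℓij = dist pi pj) (hjk : ℓjk = dist pj pk) (hki : ℓki = dist pk pi)
    (vi vj vk : ℝ)
    (hvi : vi = ℓjk ^ 2 * (ℓij ^ 2 + ℓki ^ 2 - ℓjk ^ 2))
    (hvj : vj = ℓki ^ 2 * (ℓij ^ 2 + ℓjk ^ 2 - ℓki ^ 2))
    (hvk : vk = ℓij ^ 2 * (ℓjk ^ 2 + ℓki ^ 2 - ℓij ^ 2)) :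
    vi + vj + vk ≠ 0 ∧
      (⟨![pi, pj, pk], h⟩ : Affine.Simplex ℝ P 2).circumcenter =
        Finset.univ.affineCombination ℝ ![pi, pj, pk]
          ![vi / (vi + vj + vk), vj / (vi + vj + vk), vk / (vi + vj + vk)] := by
  have hgram := h.gram_ne_zero
  set a := pj -ᵥ pi with ha
  set b := pk -ᵥ pi with hb
  set c := inner ℝ a b with hc
  have hA : ℓij ^ 2 = ‖a‖ ^ 2 := by rw [hij, dist_comm, dist_eq_norm_vsub V]
  have hB : ℓki ^ 2 = ‖b‖ ^ 2 := by rw [hki, dist_eq_norm_vsub V]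
  have hC : ℓjk ^ 2 = ‖a‖ ^ 2 - 2 * c + ‖b‖ ^ 2 := by
    rw [hjk, dist_eq_norm_vsub V, ← vsub_sub_vsub_cancel_right pj pk pi, norm_sub_sq_real]
  rw [hA, hB, hC] at hvi hvj hvk
  have hS : vi + vj + vk = 4 * (‖a‖ ^ 2 * ‖b‖ ^ 2 - c ^ 2) := by
    rw [hvi, hvj, hvk]; ring
  have hS0 : vi + vj + vk ≠ 0 := by
    rw [hS]; exact mul_ne_zero (by norm_num) hgram
  refine ⟨hS0, ?_⟩
  set w := ![vi / (vi + vj + vk), vj / (vi + vj + vk), vk / (vi + vj + vk)] with hw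
  have hw1 : ∑ i, w i = 1 := by
    simp only [hw, Fin.sum_univ_three, Matrix.cons_val]
    field_simp
  set u := (vj / (vi + vj + vk)) • a + (vk / (vi + vj + vk)) • b with hu
  have hq : Finset.univ.affineCombination ℝ ![pi, pj, pk] w = u +ᵥ pi := by
    rw [Finset.affineCombination_eq_weightedVSubOfPoint_vadd_of_sum_eq_one _ _ _ hw1 pi,
      Finset.weightedVSubOfPoint_apply, Fin.sum_univ_three]
    simp [hw, hu, ha, hb]
  have hua : 2 * inner ℝ a u = ‖a‖ ^ 2 := by
    rw [hu, inner_add_right, inner_smul_right, inner_smul_right, real_inner_self_eq_norm_sq, ← hc]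
    field_simp
    rw [hS, hvj, hvk]; ring
  have hub : 2 * inner ℝ b u = ‖b‖ ^ 2 := by
    rw [hu, inner_add_right, inner_smul_right, inner_smul_right, real_inner_self_eq_norm_sq,
      real_inner_comm, ← hc]
    field_simp
    rw [hS, hvj, hvk]; ring
  have hdist (x : P) (hx : 2 * inner ℝ (x -ᵥ pi) u = ‖x -ᵥ pi‖ ^ 2) :
      dist x (u +ᵥ pi) = ‖u‖ := by
    rw [dist_eq_norm_vsub V, vsub_vadd_eq_vsub_sub, ← sq_eq_sq₀ (norm_nonneg _) (norm_nonneg _),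
      norm_sub_sq_real, hx]
    ring
  symm
  refine Affine.Simplex.eq_circumcenter_of_dist_eq (r := ‖u‖) _
    (affineCombination_mem_affineSpan hw1 _) fun i => ?_
  rw [hq]
  fin_cases i
  · exact hdist pi (by simp)
  · exact hdist pj hua
  · exact hdist pk hub
end

section
/- Let d be a natural number with d > 3. Let a : ZMod d → ℝ satisfy a(k) > 0 for all k and ∑_{k} a(k) = 2π, and let b : ZMod d → ℝ satisfy b(k) ≥ 0 for all k and ∑_{k} b(k) = (d − 2)·π. Then there exists k ∈ ZMod d such that a(k) + a(k+1) ≤ π and b(k) ≤ π. -/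
open Real

/-- A nonnegative family with sum at most `(n - 2) * c`, where `n > 2` is the number of its
entries, has more than two entries that are at most `c`. -/
theorem two_lt_card_filter_le {ι : Type*} [Fintype ι] (b : ι → ℝ) {c : ℝ} (hc : 0 ≤ c)
    (hcard : 2 < Fintype.card ι) (hb : ∀ k, 0 ≤ b k)
    (hbsum : ∑ k, b k ≤ ((Fintype.card ι : ℝ) - 2) * c) :
    2 < (Finset.univ.filter fun k => b k ≤ c).card := by
  by_contra! h
  have hsplit := Finset.card_filter_add_card_filter_not (s := Finset.univ) fun k => b k ≤ c
  rw [Finset.card_univ] at hsplit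
  have hne : (Finset.univ.filter fun k => ¬ b k ≤ c).Nonempty :=
    Finset.card_pos.mp (by omega)
  have hlt : ∑ _k ∈ Finset.univ.filter fun k => ¬ b k ≤ c, c <
      ∑ k ∈ Finset.univ.filter fun k => ¬ b k ≤ c, b k :=
    Finset.sum_lt_sum_of_nonempty hne fun k hk => not_le.mp (Finset.mem_filter.mp hk).2
  have hle : ∑ k ∈ Finset.univ.filter (fun k => ¬ b k ≤ c), b k ≤ ∑ k, b k :=
    Finset.sum_le_univ_sum_of_nonneg hb
  rw [Finset.sum_const, nsmul_eq_mul] at hlt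
  have hcast : (Fintype.card ι : ℝ) - 2 ≤
      ((Finset.univ.filter fun k => ¬ b k ≤ c).card : ℝ) := by
    rw [sub_le_iff_le_add]
    exact_mod_cast (by omega : Fintype.card ι ≤
      (Finset.univ.filter fun k => ¬ b k ≤ c).card + 2)
  linarith [mul_le_mul_of_nonneg_right hcast hc]

/-- Two distinct cyclically consecutive pairs, each of weight more than half of the total,
overlap. -/
theorem eq_add_one_or_eq_add_one_of_lt_add {d : ℕ} [NeZero d] (hd : 1 < d) {a : ZMod d → ℝ}
    {c : ℝ} (ha : ∀ k, 0 ≤ a k) (hasum : ∑ k, a k ≤ 2 * c) {i j : ZMod d} (hij : i ≠ j)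
    (hi : c < a i + a (i + 1)) (hj : c < a j + a (j + 1)) : j = i + 1 ∨ i = j + 1 := by
  have : Fact (1 < d) := ⟨hd⟩
  by_contra! h
  have hle : ∑ k ∈ ({i, i + 1, j, j + 1} : Finset (ZMod d)), a k ≤ ∑ k, a k :=
    Finset.sum_le_univ_sum_of_nonneg ha
  rw [Finset.sum_insert (by simp [hij, h.2]),
    Finset.sum_insert (by simp [hij, h.1.symm]), Finset.sum_pair (by simp)] at hle
  linarith

/-- Around a vertex of degree d > 3 with cone angle 2π, with inner sectors a(k)
positive summing to 2π and outer corners b(k) nonnegative summing to (d−2)π,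
some incident edge has both its inner corner a(k) + a(k+1) and outer corner b(k)
at most π (so the surrounding quadrilateral is convex and the edge flippable). -/
theorem exists_flippable_edge (d : ℕ) [NeZero d] (hd : 3 < d)
    (a b : ZMod d → ℝ)
    (ha : ∀ k, 0 < a k) (hasum : ∑ k, a k = 2 * π)
    (hb : ∀ k, 0 ≤ b k) (hbsum : ∑ k, b k = ((d : ℝ) - 2) * π) :
    ∃ k : ZMod d, a k + a (k + 1) ≤ π ∧ b k ≤ π := by
  by_contra! h
  have : Fact (1 < d) := ⟨by omega⟩
  have h3 : (3 : ZMod d) ≠ 0 := fun h0 => by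
    have hdvd : d ∣ 3 := (ZMod.natCast_eq_zero_iff 3 d).mp (by exact_mod_cast h0)
    exact absurd (Nat.le_of_dvd (by norm_num) hdvd) (by omega)
  have hcard : 2 < (Finset.univ.filter fun k => b k ≤ π).card :=
    two_lt_card_filter_le b pi_pos.le (by rw [ZMod.card]; omega) hb
      (by rw [ZMod.card]; exact hbsum.le)
  obtain ⟨x, hx, y, hy, z, hz, hxy, hxz, hyz⟩ := Finset.two_lt_card.mp hcard
  have hbig : ∀ k ∈ Finset.univ.filter fun k => b k ≤ π, π < a k + a (k + 1) := fun k hk => by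
    by_contra! hk'
    exact absurd (Finset.mem_filter.mp hk).2 (not_le.mpr (h k hk'))
  have hadj {i j : ZMod d} (hij : i ≠ j) (hi : π < a i + a (i + 1))
      (hj : π < a j + a (j + 1)) : j = i + 1 ∨ i = j + 1 :=
    eq_add_one_or_eq_add_one_of_lt_add (by omega) (fun k => (ha k).le) hasum.le hij hi hj
  rcases hadj hxy (hbig x hx) (hbig y hy) with h1 | h1 <;>
  rcases hadj hxz (hbig x hx) (hbig z hz) with h2 | h2 <;>
  rcases hadj hyz (hbig y hy) (hbig z hz) with h4 | h4 <;> grind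
end

section
/- Let d be a natural number with d ≥ 4, and let a : ZMod d → ℝ satisfy a(k) > 0 for all k and ∑_{k} a(k) = 2π. Then the set {k ∈ ZMod d : a(k) + a(k+1) > π} has at most 2 elements. -/
open Real

/-- Two cyclic windows `a k + a (k + 1)` that both exceed half of the total must overlap. -/
lemma eq_add_one_or_eq_add_one_of_half_sum_lt (d : ℕ) [NeZero d] (h1 : (1 : ZMod d) ≠ 0)
    (a : ZMod d → ℝ) (ha : ∀ k, 0 ≤ a k) {s : ℝ} (hasum : ∑ k, a k = 2 * s) {i j : ZMod d}
    (hij : i ≠ j) (hi : s < a i + a (i + 1)) (hj : s < a j + a (j + 1)) :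
    j = i + 1 ∨ i = j + 1 := by
  by_contra! h
  have hle : ∑ k ∈ ({i, i + 1, j, j + 1} : Finset (ZMod d)), a k ≤ ∑ k, a k :=
    Finset.sum_le_sum_of_subset_of_nonneg (Finset.subset_univ _) fun k _ _ => ha k
  rw [Finset.sum_insert (by simp [hij, h.2, h1]),
    Finset.sum_insert (by simp [h.1.symm, hij]),
    Finset.sum_insert (by simp [h1]), Finset.sum_singleton] at hle
  linarith

/-- Among d ≥ 4 positive angular sectors summing to 2π around a vertex, at most
two consecutive-pair windows a(k) + a(k+1) can exceed π. -/
theorem at_most_two_large_inner_corners (d : ℕ) [NeZero d] (hd : 4 ≤ d)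
    (a : ZMod d → ℝ) (ha : ∀ k, 0 < a k) (hasum : ∑ k, a k = 2 * π) :
    {k : ZMod d | a k + a (k + 1) > π}.ncard ≤ 2 := by
  have h1 : (1 : ZMod d) ≠ 0 := by
    intro h
    have := Nat.le_of_dvd one_pos ((ZMod.natCast_eq_zero_iff 1 d).1 (by exact_mod_cast h))
    omega
  have h3 : (3 : ZMod d) ≠ 0 := by
    intro h
    have := Nat.le_of_dvd three_pos ((ZMod.natCast_eq_zero_iff 3 d).1 (by exact_mod_cast h))
    omega
  by_contra! h
  obtain ⟨x, y, z, hx, hy, hz, hxy, hxz, hyz⟩ := (Set.two_lt_ncard_iff (Set.toFinite _)).1 h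
  have overlap := @eq_add_one_or_eq_add_one_of_half_sum_lt d _ h1 a (fun k => (ha k).le) π hasum
  have exy := overlap hxy hx hy
  have exz := overlap hxz hx hz
  have eyz := overlap hyz hy hz
  grind
end
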